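/- Let d ≥ 1 and let ρ be a separable density matrix on ℂ^d ⊗ ℂ^d. Then tr(V·ρ) is a real number lying in the interval [0, 1], where V is the flip operator. (Consequently, any state ρ with tr(V·ρ) < 0 is entangled.) -/

import Mathlib

open Matrix Kronecker
open scoped ComplexOrder

/-- The flip operator on `ℂ^d ⊗ ℂ^d`, identified with `ℂ^(d²)` via the Kronecker
product: `V[(i,j),(k,l)] = 1` if `i = l` and `j = k`, and `0` otherwise. -/
noncomputable def flipOp (d : ℕ) : Matrix (Fin d × Fin d) (Fin d × Fin d) ℂ :=
  Matrix.of fun p q => if p.1 = q.2 ∧ p.2 = q.1 then 1 else 0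

/-- A density matrix `ρ` on `ℂ^d ⊗ ℂ^d` is separable if it is a finite convex
combination `Σᵢ pᵢ Aᵢ ⊗ Bᵢ` of Kronecker products of density matrices on `ℂ^d`. -/
def SeparableState (d : ℕ) (ρ : Matrix (Fin d × Fin d) (Fin d × Fin d) ℂ) : Prop :=
  ∃ (n : ℕ) (p : Fin n → ℝ) (A B : Fin n → Matrix (Fin d) (Fin d) ℂ),
    (∀ i, 0 ≤ p i) ∧ (∑ i, p i = 1) ∧
    (∀ i, (A i).PosSemidef ∧ (A i).trace = 1) ∧
    (∀ i, (B i).PosSemidef ∧ (B i).trace = 1) ∧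
    ρ = ∑ i, (p i : ℂ) • (A i ⊗ₖ B i)

open scoped MatrixOrder Matrix.Norms.L2Operator in
/-- The trace of a product of two positive semidefinite matrices is nonnegative. -/
theorem Matrix.PosSemidef.trace_mul_nonneg_of_posSemidef {n : Type*} [Fintype n]
    {A B : Matrix n n ℂ} (hA : A.PosSemidef) (hB : B.PosSemidef) : 0 ≤ (A * B).trace := by
  classical
  obtain ⟨X, rfl⟩ := CStarAlgebra.nonneg_iff_eq_star_mul_self.mp hA.nonneg
  rw [star_eq_conjTranspose, Matrix.mul_assoc, Matrix.trace_mul_comm]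
  exact (hB.mul_mul_conjTranspose_same X).trace_nonneg

theorem flipOp_conjTranspose (d : ℕ) : (flipOp d)ᴴ = flipOp d := by
  ext p q
  simp only [flipOp, conjTranspose_apply, of_apply, apply_ite star, star_one, star_zero]
  exact if_congr ⟨fun h => ⟨h.2.symm, h.1.symm⟩, fun h => ⟨h.2.symm, h.1.symm⟩⟩ rfl rfl

theorem flipOp_mul_apply (d : ℕ) (M : Matrix (Fin d × Fin d) (Fin d × Fin d) ℂ)
    (p q : Fin d × Fin d) : (flipOp d * M) p q = M p.swap q := by
  rw [mul_apply, Finset.sum_eq_single p.swap]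
  · simp [flipOp]
  · intro r _ hr
    have : ¬(p.1 = r.2 ∧ p.2 = r.1) := fun h => hr (Prod.ext h.2.symm h.1.symm)
    simp [flipOp, this]
  · simp

theorem flipOp_mul_self (d : ℕ) : flipOp d * flipOp d = 1 := by
  ext p q
  rw [flipOp_mul_apply]
  simp only [flipOp, of_apply, one_apply, Prod.fst_swap, Prod.snd_swap, Prod.ext_iff]
  exact if_congr and_comm rfl rfl

/-- The swap trick: `tr (V (A ⊗ B)) = tr (A B)`. -/
theorem trace_flipOp_mul_kronecker (d : ℕ) (A B : Matrix (Fin d) (Fin d) ℂ) :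
    (flipOp d * (A ⊗ₖ B)).trace = (A * B).trace := by
  simp only [trace, diag_apply, flipOp_mul_apply]
  simp only [Fintype.sum_prod_type, mul_apply, kroneckerMap_apply, Prod.fst_swap, Prod.snd_swap]
  exact Finset.sum_comm

theorem posSemidef_one_sub_flipOp (d : ℕ) : (1 - flipOp d).PosSemidef := by
  have h : (1 - flipOp d)ᴴ * (1 - flipOp d) = (2 : ℂ) • (1 - flipOp d) := by
    rw [conjTranspose_sub, conjTranspose_one, flipOp_conjTranspose, sub_mul, mul_sub, mul_sub,
      flipOp_mul_self, one_mul, one_mul, mul_one, two_smul]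
    abel
  have h' : 1 - flipOp d = (2⁻¹ : ℂ) • ((1 - flipOp d)ᴴ * (1 - flipOp d)) := by
    rw [h, smul_smul, inv_mul_cancel₀ two_ne_zero, one_smul]
  rw [h']
  exact (posSemidef_conjTranspose_mul_self _).smul (by simp)

theorem trace_flipOp_mul_nonneg_of_separableState {d : ℕ}
    {ρ : Matrix (Fin d × Fin d) (Fin d × Fin d) ℂ} (hsep : SeparableState d ρ) :
    0 ≤ (flipOp d * ρ).trace := by
  obtain ⟨n, p, A, B, hp, -, hA, hB, rfl⟩ := hsep
  simp only [Matrix.mul_sum, trace_sum, mul_smul_comm, trace_smul, trace_flipOp_mul_kronecker,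
    smul_eq_mul]
  exact Finset.sum_nonneg fun i _ => mul_nonneg (Complex.zero_le_real.mpr (hp i))
    ((hA i).1.trace_mul_nonneg_of_posSemidef (hB i).1)

/-- For a separable density matrix `ρ` on `ℂ^d ⊗ ℂ^d`, the trace `tr(V·ρ)` is a
real number lying in `[0, 1]`. -/
theorem trace_flip_mem_Icc_of_separable (d : ℕ) (hd : 1 ≤ d)
    (ρ : Matrix (Fin d × Fin d) (Fin d × Fin d) ℂ)
    (hpsd : ρ.PosSemidef) (htr : ρ.trace = 1)
    (hsep : SeparableState d ρ) :
    ∃ r : ℝ, Matrix.trace (flipOp d * ρ) = (r : ℂ) ∧ 0 ≤ r ∧ r ≤ 1 := by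
  have h0 := trace_flipOp_mul_nonneg_of_separableState hsep
  have h1 := (posSemidef_one_sub_flipOp d).trace_mul_nonneg_of_posSemidef hpsd
  rw [sub_mul, one_mul, trace_sub, htr, sub_nonneg] at h1
  rw [Complex.le_def] at h0 h1
  exact ⟨(flipOp d * ρ).trace.re, Complex.ext rfl (by simpa using h0.2.symm), h0.1, h1.1⟩
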